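/- Let V be a real vector space carrying an (s,t)-Clifford family with associated affinors F_1, …, F_k, k = 2^{s+t}. Then there exist signs ε_1, …, ε_k ∈ {−1, +1} such that for every ℝ-linear form ξ : V → ℝ the map S^ξ : V × V → V defined by S^ξ(X,Y) = Σ_{i=1}^{k} ε_i ( ξ(F_i X) F_i Y + ξ(F_i Y) F_i X ) has the following two properties: (i) S^ξ(X,Y) = S^ξ(Y,X) for all X, Y ∈ V; (ii) for every X ∈ V and every generator K ∈ {J_1, …, J_s, I_1, …, I_t} there exist real numbers c_1, …, c_k (depending only on X, ξ and K) such that S^ξ(X, K Y) − K(S^ξ(X,Y)) = Σ_{i=1}^{k} c_i F_i Y for all Y ∈ V. (Hence S^ξ belongs to the first prolongation of the Lie algebra of the group GL(m, Cl(s,t))·GL(1, Cl(s,t)) of an almost Cliffordian structure.) -/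

import Mathlib

/-- The affinor `F_S` associated to a subset `S` of the generators
`g 0, …, g (n-1)` of an `(s,t)`-Clifford family: the ordered product
`g i₁ * ⋯ * g i_r` for `S = {i₁ < ⋯ < i_r}` (the empty product being the
identity).  These `2^n` affinors realize the standard monomial basis of the
Clifford algebra `Cl(s,t)` acting on `V`. -/
noncomputable def cliffordAffinor {V : Type*} [AddCommGroup V] [Module ℝ V]
    {n : ℕ} (g : Fin n → Module.End ℝ V) (S : Finset (Fin n)) : Module.End ℝ V :=
  ((S.sort (· ≤ ·)).map g).prod

/-- The symmetrized deformation tensor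
`S^ξ(X,Y) = Σ_S ε_S ( ξ(F_S X) F_S Y + ξ(F_S Y) F_S X )`. -/
noncomputable def Sxi {V : Type*} [AddCommGroup V] [Module ℝ V]
    {n : ℕ} (g : Fin n → Module.End ℝ V) (ε : Finset (Fin n) → ℝ)
    (ξ : V →ₗ[ℝ] ℝ) (X Y : V) : V :=
  ∑ S : Finset (Fin n),
    ε S • (ξ (cliffordAffinor g S X) • cliffordAffinor g S Y
      + ξ (cliffordAffinor g S Y) • cliffordAffinor g S X)

section SignedProducts

variable {R ι : Type*} [Ring R] {g : ι → R}

/-- Products of generators along permuted lists agree up to sign. -/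
theorem prod_map_eq_or_neg_of_perm (hanti : ∀ i j, i ≠ j → g i * g j = -(g j * g i))
    {l m : List ι} (h : l.Perm m) :
    (l.map g).prod = (m.map g).prod ∨ (l.map g).prod = -(m.map g).prod := by
  induction h with
  | nil => simp
  | cons x _ ih => rcases ih with ih | ih <;> simp [ih]
  | swap x y l =>
    by_cases hxy : y = x
    · simp [hxy]
    · right
      simp [← mul_assoc, hanti y x hxy]
  | trans _ _ ih₁ ih₂ => rcases ih₁ with h₁ | h₁ <;> rcases ih₂ with h₂ | h₂ <;> simp [h₁, h₂]

/-- A product of generators commutes with each generator up to sign. -/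
theorem prod_map_mul_eq_or_neg (hanti : ∀ i j, i ≠ j → g i * g j = -(g j * g i))
    (l : List ι) (j : ι) :
    (l.map g).prod * g j = g j * (l.map g).prod ∨
      (l.map g).prod * g j = -(g j * (l.map g).prod) := by
  simpa using prod_map_eq_or_neg_of_perm hanti (List.perm_append_singleton j l)

/-- A product of generators squares to `1` or `-1`. -/
theorem prod_map_mul_self_eq_or_neg (hanti : ∀ i j, i ≠ j → g i * g j = -(g j * g i))
    (hsq : ∀ i, g i * g i = 1 ∨ g i * g i = -1) (l : List ι) :
    (l.map g).prod * (l.map g).prod = 1 ∨ (l.map g).prod * (l.map g).prod = -1 := by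
  induction l with
  | nil => simp
  | cons a l ih =>
    have key : ((a :: l).map g).prod * ((a :: l).map g).prod =
        g a * ((l.map g).prod * g a) * (l.map g).prod := by
      simp [mul_assoc]
    have hcomm : g a * (g a * (l.map g).prod) * (l.map g).prod =
        g a * g a * ((l.map g).prod * (l.map g).prod) := by
      simp [mul_assoc]
    rw [key]
    rcases prod_map_mul_eq_or_neg hanti l a with h | h <;> rcases hsq a with ha | ha <;>
      rcases ih with ih | ih <;> simp [h, hcomm, ha, ih]

end SignedProducts

section Affinors

variable {V : Type*} [AddCommGroup V] [Module ℝ V] {n : ℕ} {g : Fin n → Module.End ℝ V}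

theorem cliffordAffinor_insert (hanti : ∀ i j, i ≠ j → g i * g j = -(g j * g i))
    {S : Finset (Fin n)} {j : Fin n} (hj : j ∉ S) :
    cliffordAffinor g (insert j S) = g j * cliffordAffinor g S ∨
      cliffordAffinor g (insert j S) = -(g j * cliffordAffinor g S) := by
  have hp : ((insert j S).sort (· ≤ ·)).Perm (j :: S.sort (· ≤ ·)) := by
    rw [← Multiset.coe_eq_coe, ← Multiset.cons_coe, Finset.sort_eq, Finset.sort_eq,
      Finset.insert_val_of_notMem hj]
  simpa [cliffordAffinor] using prod_map_eq_or_neg_of_perm hanti hp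

/-- Left multiplication by a generator sends `F_S` to `F_{S ∆ {j}}` up to sign. -/
theorem cliffordAffinor_symmDiff (hanti : ∀ i j, i ≠ j → g i * g j = -(g j * g i))
    (hsq : ∀ i, g i * g i = 1 ∨ g i * g i = -1) (S : Finset (Fin n)) (j : Fin n) :
    cliffordAffinor g (symmDiff S {j}) = g j * cliffordAffinor g S ∨
      cliffordAffinor g (symmDiff S {j}) = -(g j * cliffordAffinor g S) := by
  by_cases hj : j ∈ S
  · have hT : symmDiff S {j} = S.erase j := by
      ext x
      by_cases hx : x = j <;> simp [Finset.mem_symmDiff, hx, hj]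
    have h := cliffordAffinor_insert hanti (Finset.notMem_erase j S)
    rw [Finset.insert_erase hj] at h
    rw [hT]
    rcases h with h | h <;> rcases hsq j with hs | hs <;> simp [h, ← mul_assoc, hs]
  · have hT : symmDiff S {j} = insert j S := by
      ext x
      by_cases hx : x = j <;> simp [Finset.mem_symmDiff, hx, hj]
    rw [hT]
    exact cliffordAffinor_insert hanti hj

/-- The commutator of `F_S` with a generator is a multiple of `F_{S ∆ {j}}`. -/
theorem exists_cliffordAffinor_commutator (hanti : ∀ i j, i ≠ j → g i * g j = -(g j * g i))
    (hsq : ∀ i, g i * g i = 1 ∨ g i * g i = -1) (S : Finset (Fin n)) (j : Fin n) :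
    ∃ d : ℝ, cliffordAffinor g S * g j - g j * cliffordAffinor g S =
      d • cliffordAffinor g (symmDiff S {j}) := by
  have h : cliffordAffinor g S * g j = g j * cliffordAffinor g S ∨
      cliffordAffinor g S * g j = -(g j * cliffordAffinor g S) :=
    prod_map_mul_eq_or_neg hanti _ j
  rcases h with h | h
  · exact ⟨0, by simp [h]⟩
  · rcases cliffordAffinor_symmDiff hanti hsq S j with hT | hT
    · exact ⟨-2, by rw [h, hT]; module⟩
    · exact ⟨2, by rw [h, hT]; module⟩

/-- If `ε S` is the square of `F_S`, then `Σ_S ε_S F_S ⊗ F_S` intertwines right multiplication by a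
generator on the first factor with left multiplication on the second. -/
theorem sum_cliffordAffinor_casimir (hanti : ∀ i j, i ≠ j → g i * g j = -(g j * g i))
    (hsq : ∀ i, g i * g i = 1 ∨ g i * g i = -1) {ε : Finset (Fin n) → ℝ}
    (hε : ∀ S, ε S = 1 ∨ ε S = -1)
    (hF : ∀ S, cliffordAffinor g S * cliffordAffinor g S = ε S • 1)
    (ξ : V →ₗ[ℝ] ℝ) (X Y : V) (j : Fin n) :
    ∑ S, ε S • ξ (cliffordAffinor g S (g j Y)) • cliffordAffinor g S X =
      ∑ S, ε S • ξ (cliffordAffinor g S Y) • g j (cliffordAffinor g S X) := by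
  rw [← Equiv.sum_comp (symmDiff_left_involutive ({j} : Finset (Fin n))).toPerm]
  refine Finset.sum_congr rfl fun S _ => ?_
  change ε (symmDiff S {j}) • ξ (cliffordAffinor g (symmDiff S {j}) (g j Y)) •
    cliffordAffinor g (symmDiff S {j}) X = _
  set T := symmDiff S {j}
  set F := cliffordAffinor g S
  have hST : cliffordAffinor g T = g j * F ∨ cliffordAffinor g T = -(g j * F) :=
    cliffordAffinor_symmDiff hanti hsq S j
  have hsqT : g j * F * (g j * F) = ε T • 1 := by
    rw [← hF T]
    rcases hST with h | h <;> simp [h]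
  have hconj : ε S • (g j * F * g j) = ε T • F := by
    calc ε S • (g j * F * g j) = g j * F * g j * (F * F) := by rw [hF S]; simp
      _ = g j * F * (g j * F) * F := by simp only [mul_assoc]
      _ = ε T • F := by rw [hsqT]; simp
  have hξ : ε T * ξ (g j (F (g j Y))) = ε S * ξ (F Y) := by
    have h := congrArg (fun A : Module.End ℝ V => ξ (A Y)) hconj
    simp only [LinearMap.smul_apply, Module.End.mul_apply, map_smul, smul_eq_mul] at h
    rcases hε S with h₁ | h₁ <;> rcases hε T with h₂ | h₂ <;> rw [h₁, h₂] at h ⊢ <;> linarith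
  have hterm : ε T • ξ (cliffordAffinor g T (g j Y)) • cliffordAffinor g T X =
      (ε T * ξ (g j (F (g j Y)))) • g j (F X) := by
    rcases hST with h | h <;> simp [h, mul_smul]
  rw [hterm, hξ, mul_smul]

end Affinors

/-- **Theorem 3 of the paper.**  Let `V` carry an `(s,t)`-Clifford family `g`
with associated affinors `F_S = cliffordAffinor g S` (so `k = 2^(s+t)`
affinors).  Then there exist signs `ε_S ∈ {−1, +1}` such that for every
linear form `ξ : V → ℝ` the map
`S^ξ(X,Y) = Σ_S ε_S (ξ(F_S X) F_S Y + ξ(F_S Y) F_S X)` is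
(i) symmetric, and (ii) for every `X` and every generator `K = g j` there are
reals `c_S` with `S^ξ(X, K Y) − K(S^ξ(X,Y)) = Σ_S c_S F_S Y` for all `Y`;
hence `S^ξ` lies in the first prolongation of the Lie algebra of
`GL(m, Cl(s,t))·GL(1, Cl(s,t))`. -/
theorem Sxi_mem_first_prolongation_cliffordian
    {V : Type*} [AddCommGroup V] [Module ℝ V] (s t : ℕ)
    (g : Fin (s + t) → Module.End ℝ V)
    (hsq : ∀ i : Fin (s + t), g i * g i = if (i : ℕ) < s then 1 else -1)
    (hanti : ∀ i j : Fin (s + t), i ≠ j → g i * g j = -(g j * g i)) :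
    ∃ ε : Finset (Fin (s + t)) → ℝ, (∀ S, ε S = 1 ∨ ε S = -1) ∧
      ∀ ξ : V →ₗ[ℝ] ℝ,
        (∀ X Y : V, Sxi g ε ξ X Y = Sxi g ε ξ Y X) ∧
        (∀ (X : V) (j : Fin (s + t)), ∃ c : Finset (Fin (s + t)) → ℝ,
          ∀ Y : V,
            Sxi g ε ξ X (g j Y) - g j (Sxi g ε ξ X Y)
              = ∑ S : Finset (Fin (s + t)), c S • cliffordAffinor g S Y) := by
  have hsq' : ∀ i, g i * g i = 1 ∨ g i * g i = -1 := fun i => by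
    rw [hsq i]
    split_ifs <;> simp
  have hsquare : ∀ S, ∃ e : ℝ, (e = 1 ∨ e = -1) ∧
      cliffordAffinor g S * cliffordAffinor g S = e • 1 := fun S => by
    have h : cliffordAffinor g S * cliffordAffinor g S = 1 ∨
        cliffordAffinor g S * cliffordAffinor g S = -1 :=
      prod_map_mul_self_eq_or_neg hanti hsq' _
    rcases h with h | h
    · exact ⟨1, Or.inl rfl, by simp [h]⟩
    · exact ⟨-1, Or.inr rfl, by simp [h]⟩
  choose ε hε hF using hsquare
  refine ⟨ε, hε, fun ξ => ⟨fun X Y => ?_, fun X j => ?_⟩⟩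
  · simp only [Sxi]
    exact Finset.sum_congr rfl fun S _ => by rw [add_comm]
  choose d hd using fun S => exists_cliffordAffinor_commutator hanti hsq' S j
  let τ := (symmDiff_left_involutive ({j} : Finset (Fin (s + t)))).toPerm
  refine ⟨fun S => ε (τ S) * ξ (cliffordAffinor g (τ S) X) * d (τ S), fun Y => ?_⟩
  have hcomm : ∀ S, cliffordAffinor g S (g j Y) - g j (cliffordAffinor g S Y) =
      d S • cliffordAffinor g (τ S) Y := fun S => by
    simpa [τ] using congrArg (fun A : Module.End ℝ V => A Y) (hd S)
  have hcas := sum_cliffordAffinor_casimir hanti hsq' hε hF ξ X Y j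
  rw [← Equiv.sum_comp τ]
  have hττ : ∀ S, τ (τ S) = S := symmDiff_left_involutive ({j} : Finset (Fin (s + t)))
  simp only [hττ, mul_smul, ← hcomm, Sxi, map_sum, map_smul, map_add, smul_add, smul_sub,
    Finset.sum_add_distrib, Finset.sum_sub_distrib, hcas]
  abel
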